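/- arXiv:2002.05422 — 2 statements merged into one kernel-verified Lean document; each statement's English description precedes it below -/
import Mathlib

section
/- Let γ : [0,1] → ℝ² be a C¹ curve with constant speed c > 0, normalized so that γ(0) = (0,0), let θ be a turning angle function for γ with θ(0) = 0, and assume θ(1) − θ(0) = 2mπ for some nonzero integer m. Let Q ∈ ℝ² be any point not on the loop e(t) := R_{−θ(t)}(γ(1)), t ∈ [0,1], such that the winding number of e about Q is nonzero. Then there exist cuts 0 ≤ c₁ ≤ c₂ ≤ 1 with E(c₁,c₂) = Q, i.e., Q is reachable as the endpoint of a rearranged curve. -/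
/-- Counterclockwise rotation of the plane (identified with `ℂ`) about the origin
by angle `α`: `(x,y) ↦ (x cos α − y sin α, x sin α + y cos α)`. -/
noncomputable def rot (α : ℝ) (v : ℂ) : ℂ :=
  ⟨v.re * Real.cos α - v.im * Real.sin α, v.re * Real.sin α + v.im * Real.cos α⟩

/-- Endpoint of the rearranged curve `r_{(c₁,c₂)}` (split `γ` at `c₁ ≤ c₂` and
concatenate the three arcs in the order first, third, second, matching tangent
directions at the junctions). -/
noncomputable def rearrEnd (γ : ℝ → ℂ) (θ : ℝ → ℝ) (c₁ c₂ : ℝ) : ℂ :=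
  γ c₁ + rot (θ c₁ - θ c₂) (γ 1 - γ c₂) + rot (θ 1 - θ c₂) (γ c₂ - γ c₁)

lemma rot_eq (α : ℝ) (v : ℂ) : rot α v = v * Complex.exp (α * Complex.I) := by
  apply Complex.ext <;> simp [rot, Complex.exp_ofReal_mul_I_re, Complex.exp_ofReal_mul_I_im]

lemma mk_eq (α : ℝ) : (⟨Real.cos α, Real.sin α⟩ : ℂ) = Complex.exp (α * Complex.I) := by
  apply Complex.ext <;> simp [Complex.exp_ofReal_mul_I_re, Complex.exp_ofReal_mul_I_im]

lemma exp_const (h : ℝ → ℂ) (hh : ContinuousOn h (Set.Icc 0 1))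
    (he : ∀ t ∈ Set.Icc (0:ℝ) 1, Complex.exp (h t) = Complex.exp (h 0)) : h 1 = h 0 := by
  have key : ∀ t ∈ Set.Icc (0:ℝ) 1, ∃ n : ℤ, h t = h 0 + n * (2 * Real.pi * Complex.I) :=
    fun t ht => Complex.exp_eq_exp_iff_exists_int.1 (he t ht)
  have hne : (2 * Real.pi * Complex.I : ℂ) ≠ 0 := Complex.two_pi_I_ne_zero
  let u : ℝ → ℝ := fun t => ((h t - h 0) / (2 * Real.pi * Complex.I)).re
  have hu : ContinuousOn u (Set.Icc 0 1) :=
    Complex.continuous_re.comp_continuousOn ((hh.sub continuousOn_const).div_const _)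
  have hun : ∀ t (n : ℤ), h t = h 0 + n * (2 * Real.pi * Complex.I) → u t = n := by
    intro t n hn
    simp only [u, hn, add_sub_cancel_left, mul_div_assoc, div_self hne]
    simp
  have hd : DiscreteTopology (Set.range ((↑) : ℤ → ℝ)) :=
    Int.isClosedEmbedding_coe_real.isEmbedding.toHomeomorph.symm.isEmbedding.discreteTopology
  have hc : u 1 = u 0 := by
    refine isPreconnected_Icc.constant_of_mapsTo (T := Set.range ((↑) : ℤ → ℝ)) ?_ hu ?_
      (Set.right_mem_Icc.2 zero_le_one) (Set.left_mem_Icc.2 zero_le_one)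
    · first
        | exact hd
        | exact ⟨hd⟩
    · intro t ht
      obtain ⟨n, hn⟩ := key t ht
      exact ⟨n, (hun t n hn).symm⟩
  obtain ⟨n, hn⟩ := key 1 (Set.right_mem_Icc.2 zero_le_one)
  have h0 : u 0 = 0 := by simp [u]
  rw [hun 1 n hn, h0] at hc
  rw [hn, show n = 0 by exact_mod_cast hc]
  simp

lemma cont_aux {a b : ℝ × ℝ → ℂ} {u v : ℝ × ℝ → ℝ} (ha : Continuous a) (hb : Continuous b)
    (hu : Continuous u) (hv : Continuous v) (g Q : ℂ) (w : ℝ) :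
    Continuous fun x => a x + (g - b x) * Complex.exp ((u x - v x : ℝ) * Complex.I)
      + (b x - a x) * Complex.exp ((w - v x : ℝ) * Complex.I) - Q := by
  fun_prop

lemma exists_log (F : ℝ × ℝ → ℂ) (hF : Continuous F) (h0 : ∀ x, F x ≠ 0) :
    ∃ G : ℝ × ℝ → ℂ, Continuous G ∧ ∀ x, Complex.exp (G x) = F x := by
  obtain ⟨G, ⟨-, hG⟩, -⟩ := Complex.isCoveringMapOn_exp.existsUnique_continuousMap_lifts
    (⟨F, hF⟩ : C(ℝ × ℝ, ℂ)) (a₀ := 0) (e₀ := Complex.log (F 0))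
    (Complex.exp_log (h0 0)) (by simpa using h0)
  exact ⟨G, G.continuous, fun x => congrFun hG x⟩

/-- Under the hypotheses of the two-cut theorem, any point `Q`
avoided by the loop `e(t) = R_{−θ(t)}(γ(1))` about which `e` has nonzero winding
number (witnessed by continuous polar coordinates `(ρ, φ)` of `e` with respect to
`Q` with `φ(1) − φ(0) ≠ 0`) is reachable as the endpoint of a rearranged curve:
there are cuts `0 ≤ c₁ ≤ c₂ ≤ 1` with `E(c₁,c₂) = Q`. -/
theorem reachable_points_inside_loop
    (γ : ℝ → ℂ) (θ : ℝ → ℝ) (c : ℝ) (hc : 0 < c)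
    (hγ0 : γ 0 = 0) (hθ0 : θ 0 = 0)
    (hθ : ContinuousOn θ (Set.Icc 0 1))
    (hderiv : ∀ s ∈ Set.Icc (0:ℝ) 1,
      HasDerivAt γ (c • (⟨Real.cos (θ s), Real.sin (θ s)⟩ : ℂ)) s)
    (m : ℤ) (hm : m ≠ 0) (hturn : θ 1 - θ 0 = 2 * m * Real.pi)
    (Q : ℂ) (hQ : ∀ t ∈ Set.Icc (0:ℝ) 1, rot (-θ t) (γ 1) ≠ Q)
    (ρ φ : ℝ → ℝ)
    (hρ : ContinuousOn ρ (Set.Icc 0 1)) (hφ : ContinuousOn φ (Set.Icc 0 1))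
    (hρpos : ∀ t ∈ Set.Icc (0:ℝ) 1, 0 < ρ t)
    (hpolar : ∀ t ∈ Set.Icc (0:ℝ) 1,
      rot (-θ t) (γ 1) = Q + (ρ t : ℝ) • (⟨Real.cos (φ t), Real.sin (φ t)⟩ : ℂ))
    (hwind : φ 1 - φ 0 ≠ 0) :
    ∃ c₁ c₂ : ℝ, 0 ≤ c₁ ∧ c₁ ≤ c₂ ∧ c₂ ≤ 1 ∧ rearrEnd γ θ c₁ c₂ = Q := by
  by_contra hcon
  push Not at hcon
  have hγ : ContinuousOn γ (Set.Icc 0 1) := fun s hs => (hderiv s hs).continuousAt.continuousWithinAt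
  have hθ1 : θ 1 = 2 * m * Real.pi := by rw [← hturn, hθ0, sub_zero]
  have hone : Complex.exp ((θ 1 : ℝ) * Complex.I) = 1 := by
    rw [Complex.exp_eq_one_iff]
    exact ⟨m, by rw [hθ1]; push_cast; ring⟩
  let p : ℝ → ℝ := fun x => max 0 (min x 1)
  have hp : Continuous p := by fun_prop
  have hpm : ∀ x, p x ∈ Set.Icc (0:ℝ) 1 := fun x => ⟨le_max_left _ _, by simp [p]⟩
  have hpe : ∀ x ∈ Set.Icc (0:ℝ) 1, p x = x := fun x hx => by simp [p, hx.1, hx.2]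
  have hpp : ∀ x y, p x * p y ∈ Set.Icc (0:ℝ) 1 := fun x y =>
    ⟨mul_nonneg (hpm x).1 (hpm y).1, mul_le_one₀ (hpm x).2 (hpm y).1 (hpm y).2⟩
  have z1 : (0:ℝ) ∈ Set.Icc (0:ℝ) 1 := by simp
  have o1 : (1:ℝ) ∈ Set.Icc (0:ℝ) 1 := by simp
  have c1 : Continuous fun x : ℝ × ℝ => γ (p x.1 * p x.2) :=
    hγ.comp_continuous (by fun_prop) (fun x => hpp _ _)
  have c2 : Continuous fun x : ℝ × ℝ => γ (p x.2) :=
    hγ.comp_continuous (by fun_prop) (fun x => hpm _)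
  have c3 : Continuous fun x : ℝ × ℝ => θ (p x.1 * p x.2) :=
    hθ.comp_continuous (by fun_prop) (fun x => hpp _ _)
  have c4 : Continuous fun x : ℝ × ℝ => θ (p x.2) :=
    hθ.comp_continuous (by fun_prop) (fun x => hpm _)
  obtain ⟨G, hG, hGe⟩ := exists_log
    (fun x => rearrEnd γ θ (p x.1 * p x.2) (p x.2) - Q) (by
      simp only [rearrEnd, rot_eq]
      exact cont_aux c1 c2 c3 c4 _ _ _) (fun x => sub_ne_zero.2 (hcon _ _ (hpp _ _).1
        (mul_le_of_le_one_left (hpm _).1 (hpm _).2) (hpm _).2))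
  have bd : ∀ t, rearrEnd γ θ t t = γ 1 := fun t => by simp [rearrEnd, rot_eq]
  have br : ∀ t, rearrEnd γ θ t 1 = γ 1 := fun t => by simp [rearrEnd, rot_eq]
  have be : ∀ t, rearrEnd γ θ 0 t = rot (-θ t) (γ 1) := fun t => by
    simp only [rearrEnd, rot_eq, hγ0, hθ0, zero_sub, zero_add, sub_zero]
    rw [show ((θ 1 - θ t : ℝ) : ℂ) * Complex.I
      = (θ 1 : ℝ) * Complex.I + ((-θ t : ℝ) : ℂ) * Complex.I by push_cast; ring,
      Complex.exp_add, hone]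
    ring
  have e1 : G (1, 1) = G (1, 0) := exp_const (fun t => G (1, t)) (by fun_prop) (by
    intro t ht
    simp [hGe, hpe 1 o1, hpe 0 z1, bd])
  have e2 : G (1, 0) = G (0, 0) := exp_const (fun t => G (t, 0)) (by fun_prop) (by
    intro t ht
    simp [hGe, hpe 0 z1, bd])
  have e3 : G (1, 1) = G (0, 1) := exp_const (fun t => G (t, 1)) (by fun_prop) (by
    intro t ht
    simp [hGe, hpe 1 o1, br])
  have hl : ContinuousOn (fun t => Real.log (ρ t)) (Set.Icc 0 1) :=
    hρ.log (fun t ht => (hρpos t ht).ne')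
  have hone' : ∀ t ∈ Set.Icc (0:ℝ) 1,
      Complex.exp (G (0, t) - ((Real.log (ρ t) : ℝ) + (φ t : ℝ) * Complex.I)) = 1 := by
    intro t ht
    rw [Complex.exp_sub, hGe, Complex.exp_add, ← Complex.ofReal_exp, Real.exp_log (hρpos t ht)]
    simp only [hpe 0 z1, hpe t ht, zero_mul, be]
    rw [hpolar t ht, mk_eq, add_sub_cancel_left, Complex.real_smul, div_self]
    exact mul_ne_zero (by exact_mod_cast (hρpos t ht).ne') (Complex.exp_ne_zero _)
  have e4 := exp_const
    (fun t => G (0, t) - ((Real.log (ρ t) : ℝ) + (φ t : ℝ) * Complex.I)) (by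
      refine ContinuousOn.sub (by fun_prop) (ContinuousOn.add ?_ (ContinuousOn.mul ?_ continuousOn_const))
      · exact Complex.continuous_ofReal.comp_continuousOn hl
      · exact Complex.continuous_ofReal.comp_continuousOn hφ) (by
      intro t ht
      rw [hone' t ht, hone' 0 z1])
  have e5 : G (0, 1) = G (0, 0) := by rw [← e3, e1, e2]
  have e6 := congrArg Complex.im e4
  simp [e5] at e6
  exact hwind (by linarith)
end

section
/- Let γ : [0,1] → ℝ² be a C¹ constant speed planar curve with γ(0) = (0,0), θ a turning angle function with θ(0) = 0 and θ(1) − θ(0) = 2mπ for a nonzero integer m. Let k ≥ 2, σ ∈ S_k a permutation, and z_h ∈ Z_k a cyclic shift. Then there exist cuts C ∈ D_k with e_σ(C) = (0,0) if and only if there exist cuts C′ ∈ D_k with e_{σ·z_h}(C′) = (0,0); that is, γ is (k,1)-rearrangeable with respect to σ if and only if it is (k,1)-rearrangeable with respect to the composition σ·z_h. -/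
/-- A valid vector of cuts `(c₁,…,c_{k−1}) ∈ D_k`, encoded as `c : ℕ → ℝ` with the
conventions `c 0 = 0` and `c k = 1`: `0 = c₀ ≤ c₁ ≤ … ≤ c_{k−1} ≤ c_k = 1`. -/
def IsCuts (k : ℕ) (c : ℕ → ℝ) : Prop :=
  c 0 = 0 ∧ c k = 1 ∧ ∀ i < k, c i ≤ c (i + 1)

/-- Endpoint `e_σ(C)` of the rearranged curve `r_{σ,C}`: the arcs
`γ|_[c_{i−1}, c_i]` are concatenated in the order `σ(1),…,σ(k)`, matching tangent
directions at the junctions and starting at the origin with initial direction `0`;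
`e_σ(C) = Σ_{i=1}^k R_{β_i}(γ(c_{σ(i)}) − γ(c_{σ(i)−1}))` where
`β_i = Σ_{j=1}^{i−1} (θ(c_{σ(j)}) − θ(c_{σ(j)−1})) − θ(c_{σ(i)−1})`. -/
noncomputable def rearrangedEnd (k : ℕ) (γ : ℝ → ℂ) (θ : ℝ → ℝ)
    (σ : ℕ → ℕ) (c : ℕ → ℝ) : ℂ :=
  ∑ i ∈ Finset.Icc 1 k,
    rot ((∑ j ∈ Finset.Icc 1 (i - 1), (θ (c (σ j)) - θ (c (σ j - 1))))
          - θ (c (σ i - 1)))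
      (γ (c (σ i)) - γ (c (σ i - 1)))

/-- `σ` acts on `{1,…,k}` as the cyclic shift `z_h` for some `h ∈ {0,…,k−1}`,
where `z_h(i) = i + h` if `i ≤ k − h` and `z_h(i) = i + h − k` otherwise. -/
def IsCyclicShiftOn (k : ℕ) (σ : ℕ → ℕ) : Prop :=
  ∃ h < k, ∀ i ∈ Set.Icc 1 k, σ i = if i ≤ k - h then i + h else i + h - k

lemma rot_eq_exp (α : ℝ) (v : ℂ) : rot α v = Complex.exp (α * Complex.I) * v := by
  rw [Complex.exp_mul_I, ← Complex.ofReal_cos, ← Complex.ofReal_sin]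
  apply Complex.ext <;> simp [rot, -Complex.ofReal_cos, -Complex.ofReal_sin] <;> ring

lemma sum_Icc_one_eq {M : Type*} [AddCommMonoid M] (f : ℕ → M) (n : ℕ) :
    ∑ i ∈ Finset.Icc 1 n, f i = ∑ i ∈ Finset.range n, f (i + 1) := by
  induction n with
  | zero => simp
  | succ n ih => rw [Finset.sum_Icc_succ_top (by omega), ih, Finset.sum_range_succ]

lemma cyc_sum (a a' : ℕ → ℝ) (b b' : ℕ → ℂ) (p h : ℕ)
    (h1 : ∀ i < p, a' i = a (h + i)) (h2 : ∀ i < h, a' (p + i) = a i)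
    (h3 : ∀ i < p, b' i = b (h + i)) (h4 : ∀ i < h, b' (p + i) = b i)
    (hone : Complex.exp ((∑ j ∈ Finset.range (h + p), a j : ℝ) * Complex.I) = 1) :
    Complex.exp ((∑ j ∈ Finset.range h, a j : ℝ) * Complex.I) *
      ∑ i ∈ Finset.range (p + h),
        Complex.exp ((∑ j ∈ Finset.range i, a' j : ℝ) * Complex.I) * b' i =
    ∑ i ∈ Finset.range (h + p),
        Complex.exp ((∑ j ∈ Finset.range i, a j : ℝ) * Complex.I) * b i := by
  have key : ∀ i ≤ p, ∑ j ∈ Finset.range i, a' j = ∑ j ∈ Finset.range i, a (h + j) := by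
    intro i hi
    refine Finset.sum_congr rfl fun j hj => h1 j ?_
    have := Finset.mem_range.1 hj
    omega
  rw [Finset.sum_range_add, Finset.sum_range_add _ h p, mul_add, add_comm, Finset.mul_sum,
    Finset.mul_sum]
  congr 1
  · refine Finset.sum_congr rfl fun i hi => ?_
    have hi := Finset.mem_range.1 hi
    rw [h4 i hi, ← mul_assoc, ← Complex.exp_add]
    congr 1
    have e : ∑ j ∈ Finset.range (p + i), a' j
        = ∑ j ∈ Finset.range p, a (h + j) + ∑ j ∈ Finset.range i, a j := by
      rw [Finset.sum_range_add, key p le_rfl]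
      congr 1
      refine Finset.sum_congr rfl fun j hj => h2 j ?_
      have := Finset.mem_range.1 hj
      omega
    rw [Finset.sum_range_add] at hone
    rw [e, ← one_mul (Complex.exp ((∑ j ∈ Finset.range i, a j : ℝ) * Complex.I)), ← hone,
      ← Complex.exp_add]
    congr 1
    push_cast
    ring
  · refine Finset.sum_congr rfl fun i hi => ?_
    have hi := Finset.mem_range.1 hi
    rw [h3 i hi, ← mul_assoc, ← Complex.exp_add, key i hi.le, Finset.sum_range_add]
    congr 2
    push_cast
    ring

lemma rearrangedEnd_eq (k : ℕ) (γ : ℝ → ℂ) (θ : ℝ → ℝ) (σ : ℕ → ℕ) (c : ℕ → ℝ) :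
    rearrangedEnd k γ θ σ c = ∑ i ∈ Finset.range k,
      Complex.exp ((∑ j ∈ Finset.range i,
        (θ (c (σ (j + 1))) - θ (c (σ (j + 1) - 1))) : ℝ) * Complex.I) *
      (Complex.exp (-θ (c (σ (i + 1) - 1)) * Complex.I) *
        (γ (c (σ (i + 1))) - γ (c (σ (i + 1) - 1)))) := by
  unfold rearrangedEnd
  rw [sum_Icc_one_eq]
  refine Finset.sum_congr rfl fun i _ => ?_
  rw [rot_eq_exp, sum_Icc_one_eq, ← mul_assoc, ← Complex.exp_add, Nat.add_sub_cancel]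
  congr 2
  push_cast
  ring

/-- For a `C¹` constant-speed curve `γ` with `γ(0) = 0`, turning
angle `θ` with `θ(0) = 0` and `θ(1) − θ(0) = 2mπ`, `m ≠ 0`, a permutation `σ` of
`{1,…,k}` (`k ≥ 2`) and a cyclic shift `τ = z_h ∈ Z_k`: there exist cuts
`C ∈ D_k` with `e_σ(C) = 0` iff there exist cuts `C′ ∈ D_k` with
`e_{σ·z_h}(C′) = 0`; i.e. `γ` is `(k,1)`-rearrangeable with respect to `σ` iff it
is `(k,1)`-rearrangeable with respect to `σ·z_h`. -/
theorem rearrangeable_iff_rearrangeable_comp_cyclic_shift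
    (γ : ℝ → ℂ) (θ : ℝ → ℝ) (cs : ℝ) (hcs : 0 < cs)
    (hγ0 : γ 0 = 0) (hθ0 : θ 0 = 0)
    (hθ : ContinuousOn θ (Set.Icc 0 1))
    (hderiv : ∀ s ∈ Set.Icc (0:ℝ) 1,
      HasDerivAt γ (cs • (⟨Real.cos (θ s), Real.sin (θ s)⟩ : ℂ)) s)
    (m : ℤ) (hm : m ≠ 0) (hturn : θ 1 - θ 0 = 2 * m * Real.pi)
    (k : ℕ) (hk : 2 ≤ k) (σ τ : ℕ → ℕ)
    (hσ : Set.BijOn σ (Set.Icc 1 k) (Set.Icc 1 k))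
    (h : ℕ) (hh : h < k)
    (hτ : ∀ i ∈ Set.Icc 1 k, τ i = if i ≤ k - h then i + h else i + h - k) :
    (∃ c : ℕ → ℝ, IsCuts k c ∧ rearrangedEnd k γ θ σ c = 0) ↔
    (∃ c : ℕ → ℝ, IsCuts k c ∧ rearrangedEnd k γ θ (σ ∘ τ) c = 0) := by
  refine exists_congr fun c => and_congr_right fun hc => ?_
  obtain ⟨hc0, hck, -⟩ := hc
  obtain ⟨p, rfl⟩ : ∃ p, k = h + p := ⟨k - h, by omega⟩
  have htot : ∑ j ∈ Finset.range (h + p), (θ (c (σ (j + 1))) - θ (c (σ (j + 1) - 1)))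
      = 2 * m * Real.pi := by
    rw [← sum_Icc_one_eq (fun j => θ (c (σ j)) - θ (c (σ j - 1)))]
    have : ∑ j ∈ Finset.Icc 1 (h + p), (θ (c (σ j)) - θ (c (σ j - 1)))
        = ∑ j ∈ Finset.Icc 1 (h + p), (θ (c j) - θ (c (j - 1))) := by
      refine Finset.sum_bij (fun j _ => σ j) ?_ ?_ ?_ ?_
      · intro j hj
        exact Finset.mem_Icc.2 (hσ.mapsTo (Finset.mem_Icc.1 hj))
      · intro i hi j hj hij
        exact hσ.injOn (Finset.mem_Icc.1 hi) (Finset.mem_Icc.1 hj) hij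
      · intro j hj
        obtain ⟨i, hi, e⟩ := hσ.surjOn (Finset.mem_Icc.1 hj)
        exact ⟨i, Finset.mem_Icc.2 hi, e⟩
      · intro j hj
        rfl
    rw [this, sum_Icc_one_eq]
    simp only [Nat.add_sub_cancel]
    rw [Finset.sum_range_sub (fun i => θ (c i)), hck, hc0, hturn]
  have t1 : ∀ i < p, τ (i + 1) = h + i + 1 := by
    intro i hi
    rw [hτ _ ⟨by omega, by omega⟩, if_pos (by omega)]
    omega
  have t2 : ∀ i < h, τ (p + i + 1) = i + 1 := by
    intro i hi
    rw [hτ _ ⟨by omega, by omega⟩, if_neg (by omega)]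
    omega
  have main := cyc_sum
    (fun j => θ (c (σ (j + 1))) - θ (c (σ (j + 1) - 1)))
    (fun j => θ (c ((σ ∘ τ) (j + 1))) - θ (c ((σ ∘ τ) (j + 1) - 1)))
    (fun i => Complex.exp (-θ (c (σ (i + 1) - 1)) * Complex.I) *
        (γ (c (σ (i + 1))) - γ (c (σ (i + 1) - 1))))
    (fun i => Complex.exp (-θ (c ((σ ∘ τ) (i + 1) - 1)) * Complex.I) *
        (γ (c ((σ ∘ τ) (i + 1))) - γ (c ((σ ∘ τ) (i + 1) - 1)))) p h
    (fun i hi => by simp only [Function.comp, t1 i hi])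
    (fun i hi => by simp only [Function.comp, t2 i hi])
    (fun i hi => by simp only [Function.comp, t1 i hi])
    (fun i hi => by simp only [Function.comp, t2 i hi])
    (by
      rw [htot, Complex.exp_eq_one_iff]
      exact ⟨m, by push_cast; ring⟩)
  rw [rearrangedEnd_eq, rearrangedEnd_eq, ← main, add_comm p h]
  rw [mul_eq_zero, or_iff_right (Complex.exp_ne_zero _)]
end
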